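/- The set of prime numbers does not belong to the smallest collection 𝒞 of subsets of ℕ that contains the singleton {a} for every a ∈ ℕ and is closed under binary union, binary intersection, complement in ℕ, element-wise addition, and element-wise division without remainder. Equivalently, there is no {∪, ∩, complement, +, /}-circuit whose result set is the set of primes. -/

import Mathlib

/-- Element-wise addition on subsets of ℕ. -/
def setAdd (A B : Set ℕ) : Set ℕ := {c | ∃ a ∈ A, ∃ b ∈ B, c = a + b}

/-- Element-wise division without remainder on subsets of ℕ. -/
def setDiv (A B : Set ℕ) : Set ℕ := {c | ∃ a ∈ A, ∃ b ∈ B, b ≠ 0 ∧ a = c * b}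

/-- The smallest collection of subsets of ℕ containing all singletons and closed under
union, intersection, complement, element-wise addition and element-wise division
without remainder (result sets of {∪, ∩, ‾, +, /}-circuits). -/
inductive CircSet : Set ℕ → Prop
  | single (a : ℕ) : CircSet {a}
  | union {A B : Set ℕ} : CircSet A → CircSet B → CircSet (A ∪ B)
  | inter {A B : Set ℕ} : CircSet A → CircSet B → CircSet (A ∩ B)
  | compl {A : Set ℕ} : CircSet A → CircSet Aᶜ
  | add {A B : Set ℕ} : CircSet A → CircSet B → CircSet (setAdd A B)
  | div {A B : Set ℕ} : CircSet A → CircSet B → CircSet (setDiv A B)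


theorem setAdd_finite {A B : Set ℕ} (hA : A.Finite) (hB : B.Finite) : (setAdd A B).Finite := by
  refine (hA.image2 (· + ·) hB).subset ?_
  rintro c ⟨a, ha, b, hb, rfl⟩
  exact ⟨a, ha, b, hb, rfl⟩

theorem setAdd_comm (A B : Set ℕ) : setAdd A B = setAdd B A := by
  ext c
  constructor <;> rintro ⟨a, ha, b, hb, rfl⟩ <;> exact ⟨b, hb, a, ha, add_comm _ _⟩

theorem setAdd_finite_or_compl_finite {A : Set ℕ} (B : Set ℕ) (hA : Aᶜ.Finite) :
    (setAdd A B).Finite ∨ (setAdd A B)ᶜ.Finite := by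
  rcases B.eq_empty_or_nonempty with rfl | ⟨b, hb⟩
  · left
    simp [setAdd]
  · right
    refine ((Set.finite_lt_nat b).union (hA.image (· + b))).subset fun c hc => ?_
    rcases lt_or_ge c b with h | h
    · exact Or.inl h
    · exact Or.inr ⟨c - b, fun ha => hc ⟨c - b, ha, b, hb, by omega⟩, by simp [h]⟩

theorem setDiv_finite {A : Set ℕ} (B : Set ℕ) (hA : A.Finite) : (setDiv A B).Finite := by
  obtain ⟨n, hn⟩ := hA.bddAbove
  refine (Set.finite_le_nat n).subset ?_
  rintro c ⟨a, ha, b, -, hb, rfl⟩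
  exact (Nat.le_mul_of_pos_right c (Nat.pos_of_ne_zero hb)).trans (hn ha)

theorem setDiv_finite_or_compl_finite {A : Set ℕ} (B : Set ℕ) (hA : Aᶜ.Finite) :
    (setDiv A B).Finite ∨ (setDiv A B)ᶜ.Finite := by
  by_cases h : ∃ b ∈ B, b ≠ 0
  · obtain ⟨b, hb, hb0⟩ := h
    right
    refine (hA.preimage (mul_left_injective₀ hb0).injOn).subset fun c hc ha => hc ?_
    exact ⟨c * b, ha, b, hb, hb0, rfl⟩
  · left
    refine Set.finite_empty.subset ?_
    rintro c ⟨a, -, b, hb, hb0, -⟩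
    exact h ⟨b, hb, hb0⟩

theorem CircSet.finite_or_compl_finite {A : Set ℕ} (h : CircSet A) : A.Finite ∨ Aᶜ.Finite := by
  induction h with
  | single a => exact Or.inl (Set.finite_singleton a)
  | union _ _ ihA ihB =>
    rw [Set.compl_union]
    rcases ihA with hA | hA
    · rcases ihB with hB | hB
      · exact Or.inl (hA.union hB)
      · exact Or.inr (hB.inter_of_right _)
    · exact Or.inr (hA.inter_of_left _)
  | inter _ _ ihA ihB =>
    rw [Set.compl_inter]
    rcases ihA with hA | hA
    · exact Or.inl (hA.inter_of_left _)
    · rcases ihB with hB | hB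
      · exact Or.inl (hB.inter_of_right _)
      · exact Or.inr (hA.union hB)
  | compl _ ih =>
    rw [compl_compl]
    exact ih.symm
  | @add A B _ _ ihA ihB =>
    rcases ihA with hA | hA
    · rcases ihB with hB | hB
      · exact Or.inl (setAdd_finite hA hB)
      · rw [setAdd_comm]
        exact setAdd_finite_or_compl_finite A hB
    · exact setAdd_finite_or_compl_finite B hA
  | @div A B _ _ ihA _ =>
    rcases ihA with hA | hA
    · exact Or.inl (setDiv_finite B hA)
    · exact setDiv_finite_or_compl_finite B hA

theorem primes_not_circSet : ¬ CircSet {p : ℕ | p.Prime} := by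
  intro h
  rcases h.finite_or_compl_finite with h | h
  · exact Nat.infinite_setOfPred_prime h
  · refine Set.infinite_of_injective_forall_mem (f := fun n : ℕ => (n + 2) * 2) ?_ ?_ h
    · intro m n hmn
      simp only at hmn
      omega
    · intro n
      exact Nat.not_prime_mul (by omega) (by omega)
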